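/- arXiv:0904.1651 — 2 statements merged into one kernel-verified Lean document; each statement's English description precedes it below -/
import Mathlib

section
/- Let G be the graph obtained from the complete graph on 7 vertices by deleting one edge xy, regarded as an unweighted graph. Then π_t(G, x) = 2t + 5 for t ∈ {1, 2}, and π_t(G, x) = 4t for every t ≥ 3. -/
open Finset

variable {V : Type*}

/-- Applying the pebbling move `m = (v, u)` on `G_ω`: remove `ω v u` pebbles at `v`
and add one pebble at `u`. -/
def moveFn [DecidableEq V] (ω : V → V → ℕ) (m : V × V) (p : V → ℤ) : V → ℤ :=
  fun w => if w = m.1 then p m.1 - ω m.1 m.2 else if w = m.2 then p m.2 + 1 else p w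

/-- The pebble function obtained after applying a sequence of pebbling moves. -/
def applyList [DecidableEq V] (ω : V → V → ℕ) : List (V × V) → (V → ℤ) → (V → ℤ)
  | [], p => p
  | m :: l, p => applyList ω l (moveFn ω m p)

/-- A pebbling sequence is executable from `p` if every move is along an edge of `G`
and every intermediate pebble function is nonnegative. -/
def Executable [DecidableEq V] (G : SimpleGraph V) (ω : V → V → ℕ) :
    (V → ℤ) → List (V × V) → Prop
  | _, [] => True
  | p, m :: l => G.Adj m.1 m.2 ∧ (∀ w, 0 ≤ moveFn ω m p w) ∧ Executable G ω (moveFn ω m p) l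

/-- `x` is `t`-reachable from `p` on the weighted graph `G_ω`. -/
def Reaches [DecidableEq V] (G : SimpleGraph V) (ω : V → V → ℕ) (p : V → ℤ) (x : V)
    (t : ℕ) : Prop :=
  ∃ l : List (V × V), Executable G ω p l ∧ (t : ℤ) ≤ applyList ω l p x

/-- A pebble distribution is a nonnegative pebble function. -/
def IsDistrib (p : V → ℤ) : Prop := ∀ v, 0 ≤ p v

/-- The size of a pebble distribution: the total number of pebbles. -/
def size [Fintype V] (p : V → ℤ) : ℤ := ∑ v, p v

/-- The `t`-pebbling number `π_t(G_ω, x)`: the least `m` such that `x` is `t`-reachable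
from every pebble distribution of size `m`. -/
noncomputable def piT [Fintype V] [DecidableEq V] (G : SimpleGraph V) (ω : V → V → ℕ)
    (x : V) (t : ℕ) : ℕ :=
  sInf {m : ℕ | ∀ p : V → ℤ, IsDistrib p → size p = (m : ℤ) → Reaches G ω p x t}

/-- `p_S` for a multiset `S` of pebbling moves:
`p_S(w) = p(w) + d⁻(w) − ∑ ω(w,u)` over arcs leaving `w`. -/
def applyMS [DecidableEq V] (ω : V → V → ℕ) (S : Multiset (V × V)) (p : V → ℤ) : V → ℤ :=
  fun w => p w + (Multiset.card (S.filter (fun m => m.2 = w)) : ℤ)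
    - ((S.filter (fun m => m.1 = w)).map (fun m => (ω m.1 m.2 : ℤ))).sum

/-- The transition digraph of `S` contains a directed cycle. -/
def HasCycle (S : Multiset (V × V)) : Prop :=
  ∃ l : List (V × V), l ≠ [] ∧ (l : Multiset (V × V)) ≤ S ∧
    List.Chain' (fun a b => a.2 = b.1) l ∧
    l.getLast?.map Prod.snd = l.head?.map Prod.fst

/-- A multiset of pebbling moves is acyclic if its transition digraph has no directed cycle. -/
def Acyclic (S : Multiset (V × V)) : Prop := ¬HasCycle S

/-- A list of pebbling moves is regular if each move is an initial move of the multiset of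
remaining moves: the source of each move has in-degree zero among the remaining moves. -/
def RegularSeq : List (V × V) → Prop
  | [] => True
  | m :: l => (∀ m' ∈ m :: l, m'.2 ≠ m.1) ∧ RegularSeq l

/-- The complete graph on 7 vertices with the single edge `{0, 1}` deleted
(`x = 0`, `y = 1`). -/
def K7me : SimpleGraph (Fin 7) :=
  SimpleGraph.fromRel (fun a b => ¬(a = 0 ∧ b = 1) ∧ ¬(a = 1 ∧ b = 0))

section Pebbling

variable [DecidableEq V] {G : SimpleGraph V} {ω : V → V → ℕ}

theorem moveFn_add (m : V × V) (p q : V → ℤ) :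
    moveFn ω m (p + q) = moveFn ω m p + q := by
  funext w
  simp only [moveFn, Pi.add_apply]
  split_ifs with h₁ h₂
  · subst h₁; ring
  · subst h₂; ring
  · rfl

theorem Executable.add {l : List (V × V)} {p q : V → ℤ} (hq : IsDistrib q)
    (h : Executable G ω p l) :
    Executable G ω (p + q) l ∧ applyList ω l (p + q) = applyList ω l p + q := by
  induction l generalizing p with
  | nil => exact ⟨trivial, rfl⟩
  | cons m l ih =>
    obtain ⟨hadj, hnn, hl⟩ := h
    have hm := moveFn_add (ω := ω) m p q
    refine ⟨⟨hadj, fun w => ?_, ?_⟩, ?_⟩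
    · rw [hm]
      exact add_nonneg (hnn w) (hq w)
    · rw [hm]
      exact (ih hl).1
    · rw [applyList, hm]
      exact (ih hl).2

theorem Executable.append {l₁ l₂ : List (V × V)} {p : V → ℤ} (h₁ : Executable G ω p l₁)
    (h₂ : Executable G ω (applyList ω l₁ p) l₂) : Executable G ω p (l₁ ++ l₂) := by
  induction l₁ generalizing p with
  | nil => exact h₂
  | cons m l ih => exact ⟨h₁.1, h₁.2.1, ih h₁.2.2 h₂⟩

theorem applyList_append (l₁ l₂ : List (V × V)) (p : V → ℤ) :
    applyList ω (l₁ ++ l₂) p = applyList ω l₂ (applyList ω l₁ p) := by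
  induction l₁ generalizing p with
  | nil => rfl
  | cons m l ih => exact ih _

theorem Executable.isDistrib {l : List (V × V)} {p : V → ℤ} (hp : IsDistrib p)
    (h : Executable G ω p l) : IsDistrib (applyList ω l p) := by
  induction l generalizing p with
  | nil => exact hp
  | cons m l ih => exact ih h.2.1 h.2.2

theorem Reaches.add {p q : V → ℤ} {x : V} {s t : ℕ} (hp : IsDistrib p) (hq : IsDistrib q)
    (hps : Reaches G ω p x s) (hqt : Reaches G ω q x t) : Reaches G ω (p + q) x (s + t) := by
  obtain ⟨l₁, he₁, hs⟩ := hps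
  obtain ⟨l₂, he₂, ht⟩ := hqt
  obtain ⟨h₁, h₁'⟩ := he₁.add hq
  obtain ⟨h₂, h₂'⟩ := he₂.add (he₁.isDistrib hp)
  rw [add_comm q] at h₂ h₂'
  refine ⟨l₁ ++ l₂, h₁.append (h₁' ▸ h₂), ?_⟩
  rw [applyList_append, h₁', h₂', Pi.add_apply]
  push_cast
  linarith

theorem Reaches.of_sub {p r : V → ℤ} {x : V} {t : ℕ} (h : Reaches G ω (p - r) x t) (hr : IsDistrib r)
    (hrp : IsDistrib (p - r)) (h₁ : Reaches G ω r x 1) : Reaches G ω p x (t + 1) := by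
  simpa using h.add hrp hr h₁

/-- A separable potential that no pebbling move increases bounds the potential of every
pebble function obtained by an executable sequence. -/
theorem Executable.sum_le [Fintype V] {f : V → ℤ → ℤ}
    (hf : ∀ u v, G.Adj u v → ∀ m n, f u (m - ω u v) + f v (n + 1) ≤ f u m + f v n)
    {l : List (V × V)} {p : V → ℤ} (h : Executable G ω p l) :
    ∑ w, f w (applyList ω l p w) ≤ ∑ w, f w (p w) := by
  induction l generalizing p with
  | nil => exact le_rfl
  | cons m l ih =>
    obtain ⟨hadj, -, hl⟩ := h
    refine (ih hl).trans ?_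
    rw [← sub_nonpos, ← Finset.sum_sub_distrib, Fintype.sum_eq_add m.1 m.2 hadj.ne]
    · have := hf _ _ hadj (p m.1) (p m.2)
      simp only [moveFn, if_true, if_neg hadj.ne']
      linarith
    · rintro w ⟨h₁, h₂⟩
      simp [moveFn, h₁, h₂]

theorem Reaches.le_sum [Fintype V] {f : V → ℤ → ℤ}
    (hf : ∀ u v, G.Adj u v → ∀ m n, f u (m - ω u v) + f v (n + 1) ≤ f u m + f v n)
    (hnn : ∀ v n, 0 ≤ n → 0 ≤ f v n) {x : V} (hx : Monotone (f x)) {p : V → ℤ}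
    (hp : IsDistrib p) {t : ℕ} (h : Reaches G ω p x t) : f x t ≤ ∑ w, f w (p w) := by
  obtain ⟨l, hl, ht⟩ := h
  refine (hx ht).trans (le_trans ?_ (hl.sum_le hf))
  exact Finset.single_le_sum (f := fun w => f w (applyList ω l p w))
    (fun w _ => hnn w _ (hl.isDistrib hp w)) (Finset.mem_univ x)

theorem piT_eq [Fintype V] {x : V} {t N : ℕ}
    (hub : ∀ p : V → ℤ, IsDistrib p → (N : ℤ) ≤ size p → Reaches G ω p x t)
    (hlb : ∀ m < N, ∃ p : V → ℤ, IsDistrib p ∧ size p = m ∧ ¬ Reaches G ω p x t) :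
    piT G ω x t = N := by
  refine IsLeast.csInf_eq ⟨fun p hp hs => hub p hp hs.ge, fun m hm => ?_⟩
  by_contra! hlt
  obtain ⟨p, hp, hs, hn⟩ := hlb m hlt
  exact hn (hm p hp hs)

theorem isDistrib_single (v : V) {n : ℤ} (hn : 0 ≤ n) : IsDistrib (Pi.single v n : V → ℤ) :=
  fun w => (Pi.single_nonneg (α := fun _ : V => ℤ)).2 hn w

theorem isDistrib_sub_single {p : V → ℤ} (hp : IsDistrib p) {v : V} {n : ℤ} (hn : n ≤ p v) :
    IsDistrib (p - Pi.single v n) := by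
  intro w
  rcases eq_or_ne w v with rfl | hw
  · simpa using hn
  · simpa [hw] using hp w

theorem size_sub_single [Fintype V] (p : V → ℤ) (v : V) (n : ℤ) :
    size (p - Pi.single v n) = size p - n := by
  simp [size]

end Pebbling

theorem K7me_adj {a b : Fin 7} :
    K7me.Adj a b ↔ a ≠ b ∧ ¬(a = 0 ∧ b = 1) ∧ ¬(a = 1 ∧ b = 0) := by
  simp only [K7me, SimpleGraph.fromRel_adj]
  tauto

theorem reaches_single_target :
    Reaches K7me (fun _ _ => 2) (Pi.single 0 1) 0 1 :=
  ⟨[], trivial, by simp [applyList]⟩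

theorem reaches_single_neighbor {i : Fin 7} (h₀ : i ≠ 0) (h₁ : i ≠ 1) :
    Reaches K7me (fun _ _ => 2) (Pi.single i 2) 0 1 := by
  refine ⟨[(i, 0)], ⟨K7me_adj.2 (by tauto), fun w => ?_, trivial⟩, ?_⟩
  · rcases eq_or_ne w i with rfl | hw
    · simp [moveFn]
    · by_cases hw0 : w = 0 <;> simp [moveFn, hw, hw0, h₀.symm]
  · simp [applyList, moveFn, h₀.symm]

theorem reaches_single_antipode_add_neighbor {i : Fin 7} (h₀ : i ≠ 0) (h₁ : i ≠ 1) :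
    Reaches K7me (fun _ _ => 2) (Pi.single 1 2 + Pi.single i 1) 0 1 := by
  have hm : moveFn (fun _ _ => 2) (1, i) (Pi.single 1 2 + Pi.single i 1) = Pi.single i 2 := by
    funext w
    by_cases hw1 : w = 1
    · simp [moveFn, hw1, h₁.symm]
    · by_cases hwi : w = i <;> simp [moveFn, hw1, hwi, h₁]
  obtain ⟨l, hl, ht⟩ := reaches_single_neighbor h₀ h₁
  refine ⟨(1, i) :: l, ⟨K7me_adj.2 (by tauto), ?_, ?_⟩, ?_⟩
  · rw [hm]
    exact isDistrib_single i (by norm_num)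
  · rwa [hm]
  · rwa [applyList, hm]

theorem reaches_single_antipode :
    Reaches K7me (fun _ _ => 2) (Pi.single 1 4) 0 1 := by
  have hm : moveFn (fun _ _ => 2) (1, 2) (Pi.single 1 4)
      = (Pi.single 1 2 + Pi.single 2 1 : Fin 7 → ℤ) := by
    decide
  obtain ⟨l, hl, ht⟩ := reaches_single_antipode_add_neighbor (i := 2) (by decide) (by decide)
  refine ⟨(1, 2) :: l, ⟨K7me_adj.2 (by decide), ?_, ?_⟩, ?_⟩
  · rw [hm]
    decide
  · rwa [hm]
  · rwa [applyList, hm]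

section UpperBound

variable {p : Fin 7 → ℤ} {t : ℕ}

theorem reaches_succ_of_target (hp : IsDistrib p) (h : 1 ≤ p 0)
    (ht : Reaches K7me (fun _ _ => 2) (p - Pi.single 0 1) 0 t) :
    Reaches K7me (fun _ _ => 2) p 0 (t + 1) :=
  ht.of_sub (isDistrib_single 0 (by norm_num)) (isDistrib_sub_single hp h) reaches_single_target

theorem reaches_succ_of_neighbor (hp : IsDistrib p) {i : Fin 7} (h₀ : i ≠ 0) (h₁ : i ≠ 1)
    (h : 2 ≤ p i) (ht : Reaches K7me (fun _ _ => 2) (p - Pi.single i 2) 0 t) :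
    Reaches K7me (fun _ _ => 2) p 0 (t + 1) :=
  ht.of_sub (isDistrib_single i (by norm_num)) (isDistrib_sub_single hp h)
    (reaches_single_neighbor h₀ h₁)

theorem isDistrib_sub_antipode_sub_neighbor (hp : IsDistrib p) {i : Fin 7} (h₁ : i ≠ 1)
    (hy : 2 ≤ p 1) (h : 1 ≤ p i) : IsDistrib (p - Pi.single 1 2 - Pi.single i 1) :=
  isDistrib_sub_single (isDistrib_sub_single hp hy) (by simpa [h₁] using h)

theorem reaches_succ_of_antipode_of_neighbor (hp : IsDistrib p) {i : Fin 7} (h₀ : i ≠ 0)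
    (h₁ : i ≠ 1) (hy : 2 ≤ p 1) (h : 1 ≤ p i)
    (ht : Reaches K7me (fun _ _ => 2) (p - Pi.single 1 2 - Pi.single i 1) 0 t) :
    Reaches K7me (fun _ _ => 2) p 0 (t + 1) := by
  have hd := isDistrib_sub_antipode_sub_neighbor hp h₁ hy h
  rw [sub_sub] at ht hd
  refine ht.of_sub (fun w => ?_) hd (reaches_single_antipode_add_neighbor h₀ h₁)
  exact add_nonneg (isDistrib_single 1 (by norm_num) w) (isDistrib_single i (by norm_num) w)

theorem reaches_succ_of_antipode (hp : IsDistrib p) (h : 4 ≤ p 1)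
    (ht : Reaches K7me (fun _ _ => 2) (p - Pi.single 1 4) 0 t) :
    Reaches K7me (fun _ _ => 2) p 0 (t + 1) :=
  ht.of_sub (isDistrib_single 1 (by norm_num)) (isDistrib_sub_single hp h) reaches_single_antipode

theorem reaches_zero (p : Fin 7 → ℤ) (hp : IsDistrib p) :
    Reaches K7me (fun _ _ => 2) p 0 0 :=
  ⟨[], trivial, by simpa [applyList] using hp 0⟩

theorem size_le_of_forall_neighbor_le {c : ℤ} (h : ∀ i, i ≠ 0 → i ≠ 1 → p i ≤ c) :
    size p ≤ p 0 + p 1 + 5 * c := by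
  have h2 := h 2 (by decide) (by decide)
  have h3 := h 3 (by decide) (by decide)
  have h4 := h 4 (by decide) (by decide)
  have h5 := h 5 (by decide) (by decide)
  have h6 := h 6 (by decide) (by decide)
  rw [size, Fin.sum_univ_seven]
  linarith

theorem reaches_one_of_four_le (hp : IsDistrib p) (hs : 4 ≤ size p) (hy : 2 ≤ p 1) :
    Reaches K7me (fun _ _ => 2) p 0 1 := by
  by_cases h0 : 1 ≤ p 0
  · exact reaches_succ_of_target hp h0 (reaches_zero _ (isDistrib_sub_single hp h0))
  by_cases hi : ∃ i, i ≠ 0 ∧ i ≠ 1 ∧ 1 ≤ p i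
  · obtain ⟨i, hi0, hi1, hi⟩ := hi
    exact reaches_succ_of_antipode_of_neighbor hp hi0 hi1 hy hi
      (reaches_zero _ (isDistrib_sub_antipode_sub_neighbor hp hi1 hy hi))
  have := size_le_of_forall_neighbor_le (p := p) (c := 0)
    fun i h h' => by by_contra! hc; exact hi ⟨i, h, h', hc⟩
  have h4 : 4 ≤ p 1 := by linarith
  exact reaches_succ_of_antipode hp h4 (reaches_zero _ (isDistrib_sub_single hp h4))

theorem reaches_one (hp : IsDistrib p) (hs : 7 ≤ size p) :
    Reaches K7me (fun _ _ => 2) p 0 1 := by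
  by_cases h0 : 1 ≤ p 0
  · exact reaches_succ_of_target hp h0 (reaches_zero _ (isDistrib_sub_single hp h0))
  by_cases hi : ∃ i, i ≠ 0 ∧ i ≠ 1 ∧ 2 ≤ p i
  · obtain ⟨i, hi0, hi1, hi⟩ := hi
    exact reaches_succ_of_neighbor hp hi0 hi1 hi (reaches_zero _ (isDistrib_sub_single hp hi))
  have := size_le_of_forall_neighbor_le (p := p) (c := 1)
    fun i h h' => by by_contra! hc; exact hi ⟨i, h, h', hc⟩
  exact reaches_one_of_four_le hp (by linarith) (by linarith)

theorem reaches_two (hp : IsDistrib p) (hs : 9 ≤ size p) :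
    Reaches K7me (fun _ _ => 2) p 0 2 := by
  by_cases h0 : 1 ≤ p 0
  · exact reaches_succ_of_target hp h0
      (reaches_one (isDistrib_sub_single hp h0) (by rw [size_sub_single]; linarith))
  by_cases hi : ∃ i, i ≠ 0 ∧ i ≠ 1 ∧ 2 ≤ p i
  · obtain ⟨i, hi0, hi1, hi⟩ := hi
    exact reaches_succ_of_neighbor hp hi0 hi1 hi
      (reaches_one (isDistrib_sub_single hp hi) (by rw [size_sub_single]; linarith))
  have := size_le_of_forall_neighbor_le (p := p) (c := 1)
    fun i h h' => by by_contra! hc; exact hi ⟨i, h, h', hc⟩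
  have hy : 4 ≤ p 1 := by linarith
  by_cases hj : ∃ i, i ≠ 0 ∧ i ≠ 1 ∧ 1 ≤ p i
  · obtain ⟨i, hi0, hi1, hi⟩ := hj
    have hy' : 2 ≤ p 1 := by linarith
    refine reaches_succ_of_antipode_of_neighbor hp hi0 hi1 hy' hi
      (reaches_one_of_four_le (isDistrib_sub_antipode_sub_neighbor hp hi1 hy' hi) ?_ ?_)
    · rw [size_sub_single, size_sub_single]
      linarith
    · simp [hi1.symm]
      linarith
  have := size_le_of_forall_neighbor_le (p := p) (c := 0)
    fun i h h' => by by_contra! hc; exact hj ⟨i, h, h', hc⟩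
  refine reaches_succ_of_antipode hp hy
    (reaches_one_of_four_le (isDistrib_sub_single hp hy) ?_ ?_)
  · rw [size_sub_single]
    linarith
  · simp
    linarith

/-- Unless all pebbles lie on the vertex opposite the target, a distribution of size at least
seven can move a pebble to the target at the expense of at most three pebbles. -/
theorem reaches_succ_of_antipode_lt_size (hp : IsDistrib p) {N : ℤ} (hN : 4 ≤ N) (hs : N + 3 ≤ size p)
    (ht : ∀ q : Fin 7 → ℤ, IsDistrib q → N ≤ size q → Reaches K7me (fun _ _ => 2) q 0 t)
    (hy : p 1 < size p) : Reaches K7me (fun _ _ => 2) p 0 (t + 1) := by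
  by_cases h0 : 1 ≤ p 0
  · exact reaches_succ_of_target hp h0
      (ht _ (isDistrib_sub_single hp h0) (by rw [size_sub_single]; linarith))
  by_cases hi : ∃ i, i ≠ 0 ∧ i ≠ 1 ∧ 2 ≤ p i
  · obtain ⟨i, hi0, hi1, hi⟩ := hi
    exact reaches_succ_of_neighbor hp hi0 hi1 hi
      (ht _ (isDistrib_sub_single hp hi) (by rw [size_sub_single]; linarith))
  have := size_le_of_forall_neighbor_le (p := p) (c := 1)
    fun i h h' => by by_contra! hc; exact hi ⟨i, h, h', hc⟩
  by_cases hj : ∃ i, i ≠ 0 ∧ i ≠ 1 ∧ 1 ≤ p i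
  · obtain ⟨i, hi0, hi1, hi⟩ := hj
    have hy' : 2 ≤ p 1 := by linarith
    refine reaches_succ_of_antipode_of_neighbor hp hi0 hi1 hy' hi
      (ht _ (isDistrib_sub_antipode_sub_neighbor hp hi1 hy' hi) ?_)
    rw [size_sub_single, size_sub_single]
    linarith
  have := size_le_of_forall_neighbor_le (p := p) (c := 0)
    fun i h h' => by by_contra! hc; exact hj ⟨i, h, h', hc⟩
  linarith

theorem reaches_of_antipode (hp : IsDistrib p) (h : 4 * (t : ℤ) ≤ p 1) :
    Reaches K7me (fun _ _ => 2) p 0 t := by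
  induction t generalizing p with
  | zero => exact reaches_zero p hp
  | succ t ih =>
    push_cast at h
    have hy : 4 ≤ p 1 := by linarith
    refine reaches_succ_of_antipode hp hy (ih (isDistrib_sub_single hp hy) ?_)
    simp
    linarith

theorem reaches_of_three_le (ht : 3 ≤ t) (hp : IsDistrib p) (hs : 4 * (t : ℤ) ≤ size p) :
    Reaches K7me (fun _ _ => 2) p 0 t := by
  induction t, ht using Nat.le_induction generalizing p with
  | base =>
    norm_num at hs
    by_cases hy : p 1 < size p
    · exact reaches_succ_of_antipode_lt_size hp (N := 9) (by norm_num) (by linarith)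
        (fun q hq hq' => reaches_two hq hq') hy
    · exact reaches_of_antipode hp (by push_cast; linarith)
  | succ t ht ih =>
    by_cases hy : p 1 < size p
    · push_cast at hs
      have : (3 : ℤ) ≤ t := by exact_mod_cast ht
      exact reaches_succ_of_antipode_lt_size hp (N := 4 * t) (by linarith) (by linarith)
        (fun q hq hq' => ih hq hq') hy
    · exact reaches_of_antipode hp (by linarith)

end UpperBound

section LowerBound

theorem not_reaches_single_antipode {m t : ℕ} (h : m < 4 * t) :
    ¬ Reaches K7me (fun _ _ => 2) (Pi.single 1 (m : ℤ)) 0 t := by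
  intro hr
  have := hr.le_sum (f := fun w n => (if w = 0 then 4 else if w = 1 then 1 else 2) * n)
    (fun u v huv m n => ?_) (fun v n hn => ?_) (fun a b hab => ?_)
    (isDistrib_single 1 (Int.natCast_nonneg m))
  · simp [Pi.single_apply] at this
    omega
  · rw [K7me_adj] at huv
    split_ifs <;> first | (exfalso; tauto) | (push_cast; linarith)
  · split_ifs <;> linarith
  · simpa using hab

/-- Every move destroys a pair of pebbles at a vertex and creates at most one new pair elsewhere,
where each pebble on the target counts as a pair. -/
theorem not_reaches_of_sum_div_two_lt {p : Fin 7 → ℤ} {t : ℕ} (hp : IsDistrib p)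
    (h : ∑ w, (if w = 0 then p w else p w / 2) < t) :
    ¬ Reaches K7me (fun _ _ => 2) p 0 t := by
  intro hr
  have := hr.le_sum (f := fun w n => if w = 0 then n else n / 2)
    (fun u v huv m n => ?_) (fun v n hn => ?_) (fun a b hab => ?_) hp
  · exact absurd (this.trans_lt h) (by simp)
  · split_ifs <;> push_cast <;> omega
  · split_ifs <;> omega
  · simpa using hab

theorem exists_not_reaches {m t : ℕ} (ht : 1 ≤ t) (h : m < 2 * t + 5) :
    ∃ p : Fin 7 → ℤ, IsDistrib p ∧ size p = m ∧ ¬ Reaches K7me (fun _ _ => 2) p 0 t := by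
  obtain ⟨a, b, ha, hb, rfl⟩ : ∃ a b, a < 2 * t ∧ b ≤ 5 ∧ m = a + b := by
    rcases lt_or_ge m (2 * t) with hm | hm
    · exact ⟨m, 0, hm, by omega, rfl⟩
    · exact ⟨2 * t - 1, m - (2 * t - 1), by omega, by omega, by omega⟩
  let p : Fin 7 → ℤ := fun i =>
    if i = 0 then 0 else if i = 1 then a else if (i : ℕ) < b + 2 then 1 else 0
  have hp : IsDistrib p := fun i => by
    dsimp only [p]
    split_ifs <;> omega
  refine ⟨p, hp, ?_, not_reaches_of_sum_div_two_lt hp ?_⟩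
  · simp [size, p, Fin.sum_univ_seven]
    split_ifs <;> omega
  · simp [p, Fin.sum_univ_seven]
    split_ifs <;> omega

end LowerBound

/-- For `G` the complete graph on 7 vertices minus the edge `xy`,
with all edge weights `2`: `π_t(G, x) = 2t + 5` for `t ∈ {1, 2}` and `π_t(G, x) = 4t`
for all `t ≥ 3`. -/
theorem statement5 :
    (∀ t : ℕ, t = 1 ∨ t = 2 → piT K7me (fun _ _ => 2) 0 t = 2 * t + 5) ∧
      ∀ t : ℕ, 3 ≤ t → piT K7me (fun _ _ => 2) 0 t = 4 * t := by
  refine ⟨fun t ht => piT_eq (fun p hp hs => ?_) fun m hm => exists_not_reaches (by omega) hm,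
    fun t ht => piT_eq (fun p hp hs => reaches_of_three_le ht hp (by exact_mod_cast hs))
      fun m hm => ⟨Pi.single 1 (m : ℤ), isDistrib_single 1 (Int.natCast_nonneg m), by simp [size],
        not_reaches_single_antipode hm⟩⟩
  rcases ht with rfl | rfl
  · exact reaches_one hp (by simpa using hs)
  · exact reaches_two hp (by simpa using hs)
end

section
/- (Squishing Lemma) Let G_ω be a weighted graph with goal vertex x. If x is not reachable from a pebble distribution p of size n, then there is a pebble distribution q of size n from which x is not reachable and which is squished on the thread of every unweighted open ear of G with respect to x. -/
open Finset

variable {V : Type*}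

/-- `v` is a cut vertex of the (connected) graph `G`: deleting `v` disconnects `G`. -/
def IsCutVertex {V : Type*} (G : SimpleGraph V) (v : V) : Prop :=
  ¬(G.induce {w : V | w ≠ v}).Connected

/-- An ear of `G` with respect to the goal vertex `x`: a maximal thread of
inner vertices `w 1, …, w k` of degree `2`, none equal to `x`, together with the two end
vertices `w 0` and `w (k+1)` (which coincide for a closed ear). -/
structure EarData {V : Type*} (G : SimpleGraph V) (x : V) where
  /-- the number of inner vertices -/
  k : ℕ
  kpos : 1 ≤ k
  /-- the consecutive vertices of the ear -/
  w : Fin (k + 2) → V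
  adj : ∀ i : Fin (k + 1), G.Adj (w i.castSucc) (w i.succ)
  /-- inner vertices differ from the goal vertex -/
  notx : ∀ i : Fin (k + 2), i ≠ 0 → i ≠ Fin.last (k + 1) → w i ≠ x
  /-- inner vertices have degree 2: their neighbors are exactly their ear neighbors -/
  deg2 : ∀ i : Fin (k + 2), i ≠ 0 → i ≠ Fin.last (k + 1) →
    G.neighborSet (w i) = {w (i - 1), w (i + 1)}
  /-- inner vertices are distinct from each other and from the ends -/
  inj : ∀ i j : Fin (k + 2), i ≠ 0 → i ≠ Fin.last (k + 1) → w i = w j → i = j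
  /-- maximality of the thread at the first end -/
  max0 : w 0 = x ∨ ¬∃ a b : V, a ≠ b ∧ G.neighborSet (w 0) = {a, b}
  /-- maximality of the thread at the second end -/
  maxl : w (Fin.last (k + 1)) = x ∨
    ¬∃ a b : V, a ≠ b ∧ G.neighborSet (w (Fin.last (k + 1))) = {a, b}

variable {G : SimpleGraph V} {x : V}

/-- A closed ear: the two end vertices coincide. -/
def EarData.IsClosed (E : EarData G x) : Prop :=
  E.w 0 = E.w (Fin.last (E.k + 1))

/-- A cut ear: all inner vertices are cut vertices of `G`. -/
def EarData.IsCutEar (E : EarData G x) : Prop :=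
  ∀ i : Fin (E.k + 2), i ≠ 0 → i ≠ Fin.last (E.k + 1) → IsCutVertex G (E.w i)

/-- An open ear: an ear that is neither closed nor a cut ear. -/
def EarData.IsOpen (E : EarData G x) : Prop :=
  ¬E.IsClosed ∧ ¬E.IsCutEar

/-- An unweighted ear: all of its edges have weight `2`. -/
def EarData.Unweighted (E : EarData G x) (ω : V → V → ℕ) : Prop :=
  ∀ i : Fin (E.k + 1), ω (E.w i.castSucc) (E.w i.succ) = 2

/-- `p` is squished on the thread of the ear `E`: all pebbles on the thread lie on a
single vertex or on two adjacent vertices of the thread. -/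
def EarData.SquishedOn (E : EarData G x) (p : V → ℤ) : Prop :=
  ∃ j : Fin (E.k + 2), ∀ i : Fin (E.k + 2), i ≠ 0 → i ≠ Fin.last (E.k + 1) →
    0 < p (E.w i) → i = j ∨ (i : ℕ) = (j : ℕ) + 1

/-- The change caused at `w` by the pebbling move `m`. -/
def moveDelta [DecidableEq V] (ω : V → V → ℕ) (m : V × V) (w : V) : ℤ :=
  (if m.2 = w then 1 else 0) - (if m.1 = w then (ω m.1 m.2 : ℤ) else 0)

/-- The total change caused at `w` by a multiset of pebbling moves. -/
def netChange [DecidableEq V] (ω : V → V → ℕ) (S : Multiset (V × V)) (w : V) : ℤ :=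
  (S.map (fun m => moveDelta ω m w)).sum

section NetChange

variable [DecidableEq V]

@[simp] theorem netChange_zero (ω : V → V → ℕ) (w : V) : netChange ω 0 w = 0 := by
  simp [netChange]

@[simp] theorem netChange_cons (ω : V → V → ℕ) (m : V × V) (S : Multiset (V × V)) (w : V) :
    netChange ω (m ::ₘ S) w = moveDelta ω m w + netChange ω S w := by
  simp [netChange]

theorem netChange_sub (ω : V → V → ℕ) {S T : Multiset (V × V)} (h : T ≤ S) (w : V) :
    netChange ω (S - T) w = netChange ω S w - netChange ω T w := by
  obtain ⟨U, rfl⟩ := Multiset.le_iff_exists_add.1 h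
  simp [netChange]

theorem moveFn_eq (ω : V → V → ℕ) {m : V × V} (hm : m.1 ≠ m.2) (p : V → ℤ) (w : V) :
    moveFn ω m p w = p w + moveDelta ω m w := by
  unfold moveFn moveDelta
  by_cases h1 : w = m.1
  · subst h1
    simp [hm.symm]
    ring
  · by_cases h2 : w = m.2
    · subst h2
      simp [hm, hm.symm]
    · simp [h1, h2, Ne.symm h1, Ne.symm h2]

theorem Executable.netChange_spec {G : SimpleGraph V} {ω : V → V → ℕ} {l : List (V × V)} :
    ∀ {p : V → ℤ}, IsDistrib p → Executable G ω p l →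
      (∀ m ∈ (l : Multiset (V × V)), G.Adj m.1 m.2) ∧ IsDistrib (applyList ω l p) ∧
      ∀ w, applyList ω l p w = p w + netChange ω l w := by
  induction l with
  | nil =>
    intro p hp _
    refine ⟨by simp, hp, fun w => ?_⟩
    simp [applyList, netChange]
  | cons m l ih =>
    rintro p - ⟨hadj, hnn, hex⟩
    obtain ⟨h1, h2, h3⟩ := ih hnn hex
    refine ⟨?_, h2, fun w => ?_⟩
    · intro m' hm'
      rcases List.mem_cons.1 (Multiset.mem_coe.1 hm') with rfl | h
      · exact hadj
      · exact h1 m' h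
    · rw [← Multiset.cons_coe, netChange_cons]
      change applyList ω l (moveFn ω m p) w = _
      rw [h3, moveFn_eq ω hadj.ne]
      ring

theorem sum_indicator_eq_card [Fintype V] (f : V × V → V) (S : Multiset (V × V)) :
    ∑ v, (S.map (fun m => if f m = v then (1 : ℤ) else 0)).sum = Multiset.card S := by
  induction S using Multiset.induction_on with
  | empty => simp
  | cons m S ih =>
    simp only [Multiset.map_cons, Multiset.sum_cons, Finset.sum_add_distrib, ih]
    simp [add_comm]

/-- If no move of `S` can be executed at once and yet `p` stays nonnegative after all of them,
then `S` increases the number of pebbles nowhere. -/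
theorem netChange_nonpos_of_stuck [Fintype V] {ω : V → V → ℕ} {S : Multiset (V × V)}
    {p : V → ℤ} (hω : ∀ m ∈ S, 2 ≤ ω m.1 m.2)
    (hstuck : ∀ m ∈ S, p m.1 < ω m.1 m.2) (hnn : ∀ v, 0 ≤ p v + netChange ω S v) (x : V) :
    netChange ω S x ≤ 0 := by
  set indeg : V → ℤ := fun v => (S.map (fun m => if m.2 = v then (1 : ℤ) else 0)).sum
    with hin
  set outdeg : V → ℤ := fun v => (S.map (fun m => if m.1 = v then (1 : ℤ) else 0)).sum
    with hout
  set outw : V → ℤ :=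
    fun v => (S.map (fun m => if m.1 = v then (ω m.1 m.2 : ℤ) else 0)).sum with houtw
  have hnet : ∀ v, netChange ω S v = indeg v - outw v := fun v => by
    simp [netChange, moveDelta, hin, houtw, Multiset.sum_map_sub]
  have hle2 : ∀ T : Multiset (V × V), T ≤ S → ∀ v,
      2 * (T.map (fun m => if m.1 = v then (1 : ℤ) else 0)).sum ≤
        (T.map (fun m => if m.1 = v then (ω m.1 m.2 : ℤ) else 0)).sum := by
    intro T hT v
    rw [← Multiset.sum_map_mul_left]
    refine Multiset.sum_map_le_sum_map _ _ fun m hm => ?_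
    have := hω m (Multiset.mem_of_le hT hm)
    split_ifs <;> simp
    exact_mod_cast this
  have hnonneg : ∀ (T : Multiset (V × V)) v,
      0 ≤ (T.map (fun m => if m.1 = v then (1 : ℤ) else 0)).sum := fun T v =>
    Multiset.sum_nonneg fun a ha => by
      obtain ⟨m, -, rfl⟩ := Multiset.mem_map.1 ha
      split_ifs <;> simp
  have hinnn : ∀ v, 0 ≤ indeg v := fun v =>
    Multiset.sum_nonneg fun a ha => by
      obtain ⟨m, -, rfl⟩ := Multiset.mem_map.1 ha
      split_ifs <;> simp
  have hdeg : ∀ v, outdeg v ≤ indeg v := by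
    intro v
    by_cases hv : ∃ m ∈ S, m.1 = v
    · obtain ⟨m, hm, rfl⟩ := hv
      obtain ⟨T, rfl⟩ := Multiset.exists_cons_of_mem hm
      have h1 := hle2 T (Multiset.le_cons_self T m) m.1
      have h2 := hstuck m hm
      have h3 := hnn m.1
      have h4 := hnonneg T m.1
      rw [hnet] at h3
      have h5 : outdeg m.1 = 1 + (T.map (fun m' => if m'.1 = m.1 then (1 : ℤ) else 0)).sum := by
        simp [hout]
      have h6 : outw m.1 = ω m.1 m.2 +
          (T.map (fun m' => if m'.1 = m.1 then (ω m'.1 m'.2 : ℤ) else 0)).sum := by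
        simp [houtw]
      linarith
    · have : outdeg v = 0 := Multiset.sum_eq_zero fun a ha => by
        obtain ⟨m, hm, rfl⟩ := Multiset.mem_map.1 ha
        rw [if_neg fun h => hv ⟨m, hm, h⟩]
      rw [this]
      exact hinnn v
  have hsum : ∑ v, outdeg v = ∑ v, indeg v := by
    rw [hin, hout, sum_indicator_eq_card, sum_indicator_eq_card]
  have heq := (Finset.sum_eq_sum_iff_of_le fun v _ => hdeg v).1 hsum x (Finset.mem_univ x)
  have h1 := hle2 S le_rfl x
  have h2 := hnonneg S x
  rw [hnet, ← heq]
  change 2 * outdeg x ≤ outw x at h1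
  change 0 ≤ outdeg x at h2
  linarith

/-- A multiset of moves that leaves `p` nonnegative in total witnesses reachability, whatever
the order of its moves. -/
theorem reaches_of_netChange [Fintype V] {G : SimpleGraph V} {ω : V → V → ℕ}
    (hω : ∀ u v : V, G.Adj u v → 2 ≤ ω u v) (x : V) (t : ℕ) (S : Multiset (V × V)) :
    ∀ p : V → ℤ, IsDistrib p → (∀ m ∈ S, G.Adj m.1 m.2) →
      (∀ v, 0 ≤ p v + netChange ω S v) → (t : ℤ) ≤ p x + netChange ω S x →
      Reaches G ω p x t := by
  induction hn : Multiset.card S generalizing S with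
  | zero =>
    intro p _ _ _ hx
    rw [Multiset.card_eq_zero.1 hn] at hx
    exact ⟨[], trivial, by simpa [applyList] using hx⟩
  | succ n ih =>
    intro p hp hS hnn hx
    by_cases hstuck : ∀ m ∈ S, p m.1 < ω m.1 m.2
    · have := netChange_nonpos_of_stuck (fun m hm => hω _ _ (hS m hm)) hstuck hnn x
      exact ⟨[], trivial, by simp only [applyList]; linarith⟩
    · push Not at hstuck
      obtain ⟨m, hm, hle⟩ := hstuck
      obtain ⟨T, rfl⟩ := Multiset.exists_cons_of_mem hm
      have hadj := hS m hm
      have hmove := moveFn_eq ω hadj.ne p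
      have hnn' : ∀ w, 0 ≤ moveFn ω m p w := by
        intro w
        have := hp w
        unfold moveFn
        split_ifs with h1 h2
        · linarith
        · subst h2
          linarith
        · exact this
      obtain ⟨l, hl, hlx⟩ := ih T (by simpa using hn) (moveFn ω m p) hnn'
        (fun m' hm' => hS m' (Multiset.mem_cons_of_mem hm'))
        (fun v => by have := hnn v; rw [netChange_cons] at this; rw [hmove]; linarith)
        (by rw [netChange_cons] at hx; rw [hmove]; linarith)
      exact ⟨m :: l, ⟨hadj, hnn', hl⟩, hlx⟩

/-- A reachable goal vertex is reached by a multiset of moves without pairs of opposite moves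
and without moves into a vertex other than the goal that is never left. -/
theorem Reaches.exists_reduced {G : SimpleGraph V} {ω : V → V → ℕ}
    (hω : ∀ u v : V, G.Adj u v → 2 ≤ ω u v) {q : V → ℤ} (hq : IsDistrib q) {x : V} {t : ℕ}
    (h : Reaches G ω q x t) :
    ∃ S : Multiset (V × V), (∀ m ∈ S, G.Adj m.1 m.2) ∧ (∀ v, 0 ≤ q v + netChange ω S v) ∧
      (t : ℤ) ≤ q x + netChange ω S x ∧ (∀ a b, (a, b) ∈ S → (b, a) ∉ S) ∧
      ∀ a b, (a, b) ∈ S → b ≠ x → ∃ c, (b, c) ∈ S := by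
  let P : Multiset (V × V) → Prop := fun S => (∀ m ∈ S, G.Adj m.1 m.2) ∧
    (∀ v, 0 ≤ q v + netChange ω S v) ∧ (t : ℤ) ≤ q x + netChange ω S x
  have hex : ∃ n, ∃ S, P S ∧ Multiset.card S = n := by
    obtain ⟨l, hl, hlx⟩ := h
    obtain ⟨h1, h2, h3⟩ := hl.netChange_spec hq
    exact ⟨_, l, ⟨h1, fun v => h3 v ▸ h2 v, h3 x ▸ hlx⟩, rfl⟩
  classical
  obtain ⟨S, hS, hcard⟩ := Nat.find_spec hex
  have hmin : ∀ T ≤ S, T ≠ 0 → (∀ v, 0 ≤ q v + netChange ω S v - netChange ω T v) →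
      (t : ℤ) ≤ q x + netChange ω S x - netChange ω T x → False := by
    intro T hT h0 hnn hx
    have hlt : Multiset.card (S - T) < Nat.find hex := by
      rw [← hcard, Multiset.card_sub hT]
      have := Multiset.card_pos.2 h0
      have := Multiset.card_le_card hT
      omega
    refine Nat.find_min hex hlt ⟨S - T, ⟨?_, fun v => ?_, ?_⟩, rfl⟩
    · exact fun m hm => hS.1 m (Multiset.mem_of_le (Multiset.sub_le_self S T) hm)
    · rw [netChange_sub ω hT]
      linarith [hnn v]
    · rw [netChange_sub ω hT]
      linarith
  refine ⟨S, hS.1, hS.2.1, hS.2.2, fun a b hab hba => ?_, fun a b hab hbx => ?_⟩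
  · have hadj := hS.1 _ hab
    have hne : a ≠ b := hadj.ne
    have hT : (a, b) ::ₘ {(b, a)} ≤ S := by
      rw [Multiset.le_iff_subset (by simp [hne])]
      intro m hm
      rcases Multiset.mem_cons.1 hm with rfl | hm
      · exact hab
      · rw [Multiset.mem_singleton.1 hm]
        exact hba
    have hle : ∀ v, netChange ω ((a, b) ::ₘ {(b, a)}) v ≤ 0 := by
      intro v
      have h1 : (2 : ℤ) ≤ ω a b := by exact_mod_cast hω a b hadj
      have h2 : (2 : ℤ) ≤ ω b a := by exact_mod_cast hω b a hadj.symm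
      simp only [netChange_cons, ← Multiset.cons_zero, netChange_zero, moveDelta]
      split_ifs <;> linarith
    exact hmin _ hT (by simp) (fun v => by linarith [hS.2.1 v, hle v])
      (by linarith [hS.2.2, hle x])
  · by_contra hno
    push Not at hno
    have hadj := hS.1 _ hab
    have hne : a ≠ b := hadj.ne
    have hT : {(a, b)} ≤ S := Multiset.singleton_le.2 hab
    have hnet : ∀ v, netChange ω {(a, b)} v = moveDelta ω (a, b) v := fun v => by
      simp [← Multiset.cons_zero]
    have hoff : ∀ v, v ≠ b → netChange ω {(a, b)} v ≤ 0 := by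
      intro v hv
      rw [hnet, moveDelta, if_neg (Ne.symm hv)]
      split_ifs <;> simp
    have hb : 1 ≤ netChange ω S b := by
      have h1 : moveDelta ω (a, b) b = 1 := by simp [moveDelta, hne]
      rw [← h1]
      refine Multiset.single_le_sum ?_ _ (Multiset.mem_map_of_mem _ hab)
      intro d hd
      obtain ⟨m, hm, rfl⟩ := Multiset.mem_map.1 hd
      have : m.1 ≠ b := fun h => hno m.2 (by rw [← h]; exact hm)
      rw [moveDelta, if_neg this]
      split_ifs <;> simp
    refine hmin _ hT (by simp) (fun v => ?_) (by linarith [hS.2.2, hoff x hbx.symm])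
    by_cases hv : v = b
    · subst hv
      have : netChange ω {(a, v)} v = 1 := by rw [hnet]; simp [moveDelta, hne]
      linarith [hq v]
    · linarith [hS.2.1 v, hoff v hv]

/-- If no move of `S` leaves `v`, then the net change at `v` is nonnegative. -/
theorem netChange_nonneg_of_no_out (ω : V → V → ℕ) {S : Multiset (V × V)} {v : V}
    (h : ∀ m ∈ S, m.1 ≠ v) : 0 ≤ netChange ω S v := by
  refine Multiset.sum_nonneg fun d hd => ?_
  obtain ⟨m, hm, rfl⟩ := Multiset.mem_map.1 hd
  rw [moveDelta, if_neg (h m hm)]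
  split_ifs <;> simp

/-- The net change caused by one move along each of the edges `f c, g c`, all of weight `2`. -/
theorem netChange_map_finset {ω : V → V → ℕ} {f g : ℕ → V} {A : Finset ℕ}
    (h : ∀ c ∈ A, ω (f c) (g c) = 2) (v : V) :
    netChange ω (A.val.map fun c => (f c, g c)) v =
      ∑ c ∈ A, ((Pi.single (g c) 1 : V → ℤ) v - 2 * (Pi.single (f c) 1 : V → ℤ) v) := by
  rw [netChange, Multiset.map_map]
  refine Finset.sum_congr rfl fun c hc => ?_
  simp [moveDelta, h c hc, Pi.single_apply, eq_comm]

end NetChange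

/-- The data of an unweighted ear with inner vertices `f 1, …, f k` that the squishing argument
uses, with vertices indexed by natural numbers. -/
structure IsUnweightedThread (G : SimpleGraph V) (ω : V → V → ℕ) (x : V) (k : ℕ)
    (f : ℕ → V) : Prop where
  ne_goal : ∀ a, 1 ≤ a → a ≤ k → f a ≠ x
  inj : ∀ a b, 1 ≤ a → a ≤ k → 1 ≤ b → b ≤ k → f a = f b → a = b
  adj : ∀ a, 1 ≤ a → a ≤ k → ∀ u, G.Adj (f a) u → u = f (a - 1) ∨ u = f (a + 1)
  weight : ∀ a, 1 ≤ a → a < k → ω (f a) (f (a + 1)) = 2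

/-- Moving one pebble on `f i` and one pebble on `f j` a step towards each other. -/
def squishStep [DecidableEq V] (f : ℕ → V) (i j : ℕ) (p : V → ℤ) (v : V) : ℤ :=
  p v - (Pi.single (f i) 1 : V → ℤ) v - (Pi.single (f j) 1 : V → ℤ) v
    + (Pi.single (f (i + 1)) 1 : V → ℤ) v + (Pi.single (f (j - 1)) 1 : V → ℤ) v

section Squish

variable [DecidableEq V]

theorem single_one_nonneg (u v : V) : (0 : ℤ) ≤ (Pi.single u 1 : V → ℤ) v := by
  rw [Pi.single_apply]
  split_ifs <;> simp

theorem squishStep_isDistrib {f : ℕ → V} {i j : ℕ} {p : V → ℤ} (hp : IsDistrib p)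
    (hij : f i ≠ f j) (hi : 0 < p (f i)) (hj : 0 < p (f j)) :
    IsDistrib (squishStep f i j p) := by
  intro v
  have h1 := single_one_nonneg (f (i + 1)) v
  have h2 := single_one_nonneg (f (j - 1)) v
  have h3 : (Pi.single (f i) 1 : V → ℤ) v + (Pi.single (f j) 1 : V → ℤ) v ≤ p v := by
    simp only [Pi.single_apply]
    have := hp v
    split_ifs with ha hb hb
    · exact absurd (ha.symm.trans hb) hij
    · subst ha; linarith
    · subst hb; linarith
    · linarith
  unfold squishStep
  linarith

theorem size_squishStep [Fintype V] (f : ℕ → V) (i j : ℕ) (p : V → ℤ) :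
    size (squishStep f i j p) = size p := by
  simp [size, squishStep, Finset.sum_add_distrib, Finset.sum_sub_distrib]

theorem squishStep_not_reaches [Fintype V] {G : SimpleGraph V} {ω : V → V → ℕ}
    (hsym : ∀ u v : V, ω u v = ω v u) (hω : ∀ u v : V, G.Adj u v → 2 ≤ ω u v)
    {x : V} {k : ℕ} {f : ℕ → V} (hf : IsUnweightedThread G ω x k f)
    {i j : ℕ} (hi1 : 1 ≤ i) (hij : i + 2 ≤ j) (hjk : j ≤ k)
    {p : V → ℤ} (hp : IsDistrib p) (hi : 0 < p (f i)) (hj : 0 < p (f j)) {t : ℕ}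
    (hnr : ¬Reaches G ω p x t) : ¬Reaches G ω (squishStep f i j p) x t := by
  intro hr
  have hq : IsDistrib (squishStep f i j p) := squishStep_isDistrib hp
    (fun h => by have := hf.inj i j hi1 (by omega) (by omega) hjk h; omega) hi hj
  obtain ⟨S, hS, hnn, hx, hcyc, hsink⟩ := hr.exists_reduced hω hq
  set e : ℕ → V → ℤ := fun c => (Pi.single (f c) 1 : V → ℤ) with he
  have he0 : ∀ c v, 0 ≤ e c v := fun c v => single_one_nonneg (f c) v
  set D : V → ℤ := fun v => e (i + 1) v + e (j - 1) v - e i v - e j v with hD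
  have hqD : ∀ v, squishStep f i j p v = p v + D v :=
    fun v => by simp only [squishStep, hD, he]; ring
  have hne : ∀ a b, i ≤ a → a ≤ j → i ≤ b → b ≤ j → a ≠ b → f a ≠ f b :=
    fun a b _ _ _ _ hab h => hab (hf.inj a b (by omega) (by omega) (by omega) (by omega) h)
  have hself : ∀ c, e c (f c) = 1 := fun c => by simp [he]
  have hoff : ∀ c v, v ≠ f c → e c v = 0 := fun c v h => by simp [he, h]
  have hdone : ∀ T ≤ S, (∀ v, D v ≤ -netChange ω T v ∨ (v = f (i + 1) ∨ v = f (j - 1)) ∧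
      D v ≤ squishStep f i j p v + netChange ω S v - netChange ω T v) → False := by
    intro T hT h
    refine hnr (reaches_of_netChange hω x t (S - T) p hp
      (fun m hm => hS m (Multiset.mem_of_le (Multiset.sub_le_self S T) hm)) (fun v => ?_) ?_)
    · rw [netChange_sub ω hT]
      have h1 := hqD v
      have h2 := hnn v
      rcases h v with h3 | ⟨-, h3⟩ <;> linarith
    · rw [netChange_sub ω hT]
      have h1 := hqD x
      rcases h x with h3 | ⟨h3 | h3, -⟩
      · linarith
      · exact absurd h3.symm (hf.ne_goal _ (by omega) (by omega))
      · exact absurd h3.symm (hf.ne_goal _ (by omega) (by omega))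
  have hout : ∀ c, i < c → c < j → ∀ m ∈ S, m.1 = f c →
      m = (f c, f (c - 1)) ∨ m = (f c, f (c + 1)) := by
    rintro c hc hcj ⟨a, b⟩ hm rfl
    rcases hf.adj c (by omega) (by omega) b (hS _ hm) with rfl | rfl <;> simp
  have hright : ∀ c, i < c → c + 1 < j → (f c, f (c + 1)) ∈ S →
      (f (c + 1), f (c + 1 + 1)) ∈ S := by
    intro c hc hcj hm
    obtain ⟨u, hu⟩ := hsink _ _ hm (hf.ne_goal _ (by omega) (by omega))
    rcases hout (c + 1) (by omega) hcj _ hu rfl with h | h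
    · rw [h] at hu
      exact absurd hu (hcyc _ _ hm)
    · rwa [h] at hu
  have hleft : ∀ c, i ≤ c → c + 2 < j → (f (c + 2), f (c + 1)) ∈ S →
      (f (c + 1), f c) ∈ S := by
    intro c hc hcj hm
    obtain ⟨u, hu⟩ := hsink _ _ hm (hf.ne_goal _ (by omega) (by omega))
    rcases hout (c + 1) (by omega) (by omega) _ hu rfl with h | h
    · rwa [h] at hu
    · rw [h] at hu
      exact absurd hu (hcyc _ _ hm)
  -- a path of moves from `f (i + 1)` to `f j` can be deleted
  have hR : (f (i + 1), f (i + 2)) ∉ S := by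
    intro hm
    have hall : ∀ c, i + 1 ≤ c → c < j → (f c, f (c + 1)) ∈ S := by
      intro c hc
      induction c, hc using Nat.le_induction with
      | base => exact fun _ => hm
      | succ c hc ih => exact fun hcj => hright c (by omega) hcj (ih (by omega))
    refine hdone ((Finset.Ico (i + 1) j).val.map fun c => (f c, f (c + 1))) ?_
      fun v => Or.inl ?_
    · rw [Multiset.le_iff_subset]
      · intro m hm
        obtain ⟨c, hc, rfl⟩ := Multiset.mem_map.1 hm
        have := Finset.mem_Ico.1 (Finset.mem_def.2 hc)
        exact hall c this.1 this.2
      · refine Multiset.Nodup.map_on (fun a ha b hb hab => ?_) (Finset.nodup _)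
        have ha := Finset.mem_Ico.1 (Finset.mem_def.2 ha)
        have hb := Finset.mem_Ico.1 (Finset.mem_def.2 hb)
        by_contra hne'
        exact hne a b (by omega) (by omega) (by omega) (by omega) hne' (Prod.ext_iff.1 hab).1
    · rw [netChange_map_finset fun c hc => by
        have := Finset.mem_Ico.1 hc
        exact hf.weight c (by omega) (by omega)]
      have h1 : ∑ c ∈ Finset.Ico (i + 1) j, (e (c + 1) v - 2 * e c v) =
          (e j v - e (i + 1) v) - ∑ c ∈ Finset.Ico (i + 1) j, e c v := by
        rw [← Finset.sum_Ico_sub (fun c => e c v) (show i + 1 ≤ j by omega),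
          ← Finset.sum_sub_distrib]
        exact Finset.sum_congr rfl fun c _ => by ring
      have h2 : e (j - 1) v ≤ ∑ c ∈ Finset.Ico (i + 1) j, e c v :=
        Finset.single_le_sum (f := fun c => e c v) (fun c _ => he0 c v)
          (Finset.mem_Ico.2 ⟨by omega, by omega⟩)
      change D v ≤ -∑ c ∈ Finset.Ico (i + 1) j, (e (c + 1) v - 2 * e c v)
      rw [h1]
      have := he0 i v
      simp only [hD]
      linarith
  -- a path of moves from `f (j - 1)` to `f i` can be deleted
  have hL : (f (j - 1), f (j - 2)) ∉ S := by
    intro hm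
    have hall : ∀ d c, c + d + 2 = j → i ≤ c → (f (c + 1), f c) ∈ S := by
      intro d
      induction d with
      | zero =>
        rintro c rfl hc
        exact hm
      | succ d ih => exact fun c hcj hc => hleft c hc (by omega) (ih (c + 1) (by omega) (by omega))
    refine hdone ((Finset.Ico i (j - 1)).val.map fun c => (f (c + 1), f c)) ?_
      fun v => Or.inl ?_
    · rw [Multiset.le_iff_subset]
      · intro m hm
        obtain ⟨c, hc, rfl⟩ := Multiset.mem_map.1 hm
        have := Finset.mem_Ico.1 (Finset.mem_def.2 hc)
        exact hall (j - 2 - c) c (by omega) this.1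
      · refine Multiset.Nodup.map_on (fun a ha b hb hab => ?_) (Finset.nodup _)
        have ha := Finset.mem_Ico.1 (Finset.mem_def.2 ha)
        have hb := Finset.mem_Ico.1 (Finset.mem_def.2 hb)
        by_contra hne'
        exact hne a b (by omega) (by omega) (by omega) (by omega) hne' (Prod.ext_iff.1 hab).2
    · rw [netChange_map_finset fun c hc => by
        have := Finset.mem_Ico.1 hc
        rw [hsym]
        exact hf.weight c (by omega) (by omega)]
      have h1 : ∑ c ∈ Finset.Ico i (j - 1), (e c v - 2 * e (c + 1) v) =
          -(e (j - 1) v - e i v) - ∑ c ∈ Finset.Ico i (j - 1), e (c + 1) v := by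
        rw [← Finset.sum_Ico_sub (fun c => e c v) (show i ≤ j - 1 by omega),
          ← Finset.sum_neg_distrib, ← Finset.sum_sub_distrib]
        exact Finset.sum_congr rfl fun c _ => by ring
      have h2 : e (i + 1) v ≤ ∑ c ∈ Finset.Ico i (j - 1), e (c + 1) v :=
        Finset.single_le_sum (f := fun c => e (c + 1) v) (fun c _ => he0 (c + 1) v)
          (Finset.mem_Ico.2 ⟨by omega, by omega⟩)
      change D v ≤ -∑ c ∈ Finset.Ico i (j - 1), (e c v - 2 * e (c + 1) v)
      rw [h1]
      have := he0 j v
      simp only [hD]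
      linarith
  rcases Nat.eq_or_lt_of_le hij with rfl | hlt
  · refine hdone 0 (Multiset.zero_le S) fun v => ?_
    have h1 := he0 i v
    have h2 := he0 (i + 2) v
    by_cases hv : v = f (i + 1)
    · subst hv
      refine Or.inr ⟨Or.inl rfl, ?_⟩
      have h3 := netChange_nonneg_of_no_out ω (S := S) (v := f (i + 1)) fun m hm h => by
        rcases hout (i + 1) (by omega) (by omega) m hm h with rfl | rfl
        · exact hL hm
        · exact hR hm
      rw [hqD, netChange_zero]
      linarith [hp (f (i + 1))]
    · refine Or.inl ?_
      have h3 := hoff (i + 1) v hv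
      simp only [hD, netChange_zero, Nat.add_succ_sub_one]
      linarith
  · have hsingle : ∀ a b, ω (f a) (f b) = 2 → ∀ v,
        netChange ω {(f a, f b)} v = e b v - 2 * e a v := by
      intro a b hab v
      simp [netChange, moveDelta, hab, he, Pi.single_apply, eq_comm]
    -- an extra pebble on `f a` is either unused or can be left on `f b` instead
    have hdel : ∀ a b, i < a → a < j → ω (f a) (f b) = 2 →
        (∀ m ∈ S, m.1 = f a → m = (f a, f b)) → 1 ≤ squishStep f i j p (f a) →
        ∃ T ≤ S, (∀ m ∈ T, m.1 = f a) ∧ ∀ v, e a v - e b v ≤ -netChange ω T v ∨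
          v = f a ∧ e a v - e b v ≤
            squishStep f i j p v + netChange ω S v - netChange ω T v := by
      intro a b ha haj hab hm hq1
      by_cases h : (f a, f b) ∈ S
      · refine ⟨{(f a, f b)}, Multiset.singleton_le.2 h, by simp, fun v => Or.inl ?_⟩
        rw [hsingle a b hab]
        linarith [he0 a v]
      · refine ⟨0, Multiset.zero_le S, by simp, fun v => ?_⟩
        have hb := he0 b v
        by_cases hv : v = f a
        · subst hv
          have h3 := netChange_nonneg_of_no_out ω (S := S) (v := f a)
            fun m hmS h' => h (hm m hmS h' ▸ hmS)
          have := hself a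
          exact Or.inr ⟨rfl, by rw [netChange_zero]; linarith⟩
        · rw [hoff a v hv, netChange_zero]
          exact Or.inl (by linarith)
    have hDi : 1 ≤ D (f (i + 1)) := by
      have h1 := hoff i _ (hne (i + 1) i (by omega) (by omega) (by omega) (by omega) (by omega))
      have h2 := hoff j _ (hne (i + 1) j (by omega) (by omega) (by omega) (by omega) (by omega))
      have h3 := hself (i + 1)
      have h4 := he0 (j - 1) (f (i + 1))
      simp only [hD]
      linarith
    have hDj : 1 ≤ D (f (j - 1)) := by
      have h1 := hoff i _ (hne (j - 1) i (by omega) (by omega) (by omega) (by omega) (by omega))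
      have h2 := hoff j _ (hne (j - 1) j (by omega) (by omega) (by omega) (by omega) (by omega))
      have h3 := hself (j - 1)
      have h4 := he0 (i + 1) (f (j - 1))
      simp only [hD]
      linarith
    have hij' : f (i + 1) ≠ f (j - 1) :=
      hne _ _ (by omega) (by omega) (by omega) (by omega) (by omega)
    have hj1 : j - 1 + 1 = j := by omega
    obtain ⟨T₁, hT₁, hs₁, h₁⟩ := hdel (i + 1) i (by omega) (by omega)
      (by rw [hsym]; exact hf.weight i (by omega) (by omega))
      (fun m hm h => (hout (i + 1) (by omega) (by omega) m hm h).resolve_right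
        fun h' => hR (h' ▸ hm))
      (by rw [hqD]; linarith [hp (f (i + 1))])
    obtain ⟨T₂, hT₂, hs₂, h₂⟩ := hdel (j - 1) j (by omega) (by omega)
      (by have := hf.weight (j - 1) (by omega) (by omega); rwa [hj1] at this)
      (fun m hm h => by
        rcases hout (j - 1) (by omega) (by omega) m hm h with h' | h'
        · exact absurd (h' ▸ hm) hL
        · rwa [hj1] at h')
      (by rw [hqD]; linarith [hp (f (j - 1))])
    have hdisj : Disjoint T₁ T₂ := Multiset.disjoint_left.2 fun {m} hm₁ hm₂ =>
      hij' ((hs₁ m hm₁).symm.trans (hs₂ m hm₂))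
    refine hdone (T₁ + T₂) ?_ fun v => ?_
    · rw [(Multiset.add_eq_union_iff_disjoint).2 hdisj]
      exact Multiset.union_le hT₁ hT₂
    · have hadd : netChange ω (T₁ + T₂) v = netChange ω T₁ v + netChange ω T₂ v := by
        simp [netChange]
      rw [hadd]
      simp only [hD]
      rcases h₁ v with h | ⟨hv, h⟩ <;> rcases h₂ v with h' | ⟨hv', h'⟩
      · exact Or.inl (by linarith)
      · exact Or.inr ⟨Or.inr hv', by linarith⟩
      · exact Or.inr ⟨Or.inl hv, by linarith⟩
      · exact absurd (hv.symm.trans hv') hij'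

/-- The moment of the pebbles on a thread, which every squishing step decreases. -/
def threadMoment (f : ℕ → V) (k : ℕ) (p : V → ℤ) : ℤ :=
  ∑ c ∈ Finset.Icc 1 k, p (f c) * (c : ℤ) ^ 2

theorem threadMoment_squishStep_lt {G : SimpleGraph V} {ω : V → V → ℕ} {x : V} {k : ℕ}
    {f : ℕ → V} (hf : IsUnweightedThread G ω x k f) {i j : ℕ} (hi1 : 1 ≤ i)
    (hij : i + 2 ≤ j) (hjk : j ≤ k) (p : V → ℤ) :
    threadMoment f k (squishStep f i j p) < threadMoment f k p := by
  have hsingle : ∀ a, 1 ≤ a → a ≤ k →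
      ∑ c ∈ Finset.Icc 1 k, (Pi.single (f a) 1 : V → ℤ) (f c) * (c : ℤ) ^ 2 = (a : ℤ) ^ 2 := by
    intro a ha hak
    rw [Finset.sum_eq_single_of_mem a (Finset.mem_Icc.2 ⟨ha, hak⟩)]
    · simp
    · intro c hc hca
      have hc := Finset.mem_Icc.1 hc
      rw [Pi.single_eq_of_ne fun h => hca (hf.inj c a hc.1 hc.2 ha hak h), zero_mul]
  have h : threadMoment f k (squishStep f i j p) =
      threadMoment f k p - (i : ℤ) ^ 2 - (j : ℤ) ^ 2 + ((i + 1 : ℕ) : ℤ) ^ 2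
        + ((j - 1 : ℕ) : ℤ) ^ 2 := by
    rw [← hsingle i hi1 (by omega), ← hsingle j (by omega) hjk,
      ← hsingle (i + 1) (by omega) (by omega), ← hsingle (j - 1) (by omega) (by omega)]
    simp only [threadMoment, squishStep, add_mul, sub_mul, Finset.sum_add_distrib,
      Finset.sum_sub_distrib]
  rw [h]
  push_cast [show 1 ≤ j by omega]
  have : (i : ℤ) + 2 ≤ j := by exact_mod_cast hij
  nlinarith

theorem exists_squished_on_thread [Fintype V] {G : SimpleGraph V} {ω : V → V → ℕ}
    (hsym : ∀ u v : V, ω u v = ω v u) (hω : ∀ u v : V, G.Adj u v → 2 ≤ ω u v)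
    {x : V} {k : ℕ} {f : ℕ → V} (hf : IsUnweightedThread G ω x k f) {t : ℕ} (p : V → ℤ)
    (hp : IsDistrib p) (hnr : ¬Reaches G ω p x t) :
    ∃ q : V → ℤ, IsDistrib q ∧ size q = size p ∧ ¬Reaches G ω q x t ∧
      (∀ v, (∀ a, 1 ≤ a → a ≤ k → v ≠ f a) → q v = p v) ∧
      ∀ a b, 1 ≤ a → a ≤ k → 1 ≤ b → b ≤ k → 0 < q (f a) → 0 < q (f b) → b ≤ a + 1 := by
  induction hn : (threadMoment f k p).toNat using Nat.strong_induction_on generalizing p with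
  | _ n ih =>
    by_cases hsq : ∀ a b, 1 ≤ a → a ≤ k → 1 ≤ b → b ≤ k → 0 < p (f a) → 0 < p (f b) → b ≤ a + 1
    · exact ⟨p, hp, rfl, hnr, fun _ _ => rfl, hsq⟩
    · push Not at hsq
      obtain ⟨i, j, hi1, hik, hj1, hjk, hi, hj, hij⟩ := hsq
      have hd := squishStep_isDistrib hp
        (fun h => by have := hf.inj i j hi1 hik hj1 hjk h; omega) hi hj
      have hlt := threadMoment_squishStep_lt hf hi1 hij hjk p
      have hnn : 0 ≤ threadMoment f k (squishStep f i j p) :=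
        Finset.sum_nonneg fun c _ => mul_nonneg (hd _) (sq_nonneg _)
      obtain ⟨q, hq, hsize, hqr, hoff, hqs⟩ := ih _ (by omega) (squishStep f i j p) hd
        (squishStep_not_reaches hsym hω hf hi1 hij hjk hp hi hj hnr) rfl
      refine ⟨q, hq, hsize.trans (size_squishStep f i j p), hqr, fun v hv => ?_, hqs⟩
      rw [hoff v hv, squishStep, Pi.single_eq_of_ne (hv i hi1 hik),
        Pi.single_eq_of_ne (hv j hj1 hjk), Pi.single_eq_of_ne (hv (i + 1) (by omega) (by omega)),
        Pi.single_eq_of_ne (hv (j - 1) (by omega) (by omega))]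
      ring

end Squish

namespace EarData

/-- The vertices of an ear, indexed by natural numbers. -/
def vert (E : EarData G x) (c : ℕ) : V :=
  if h : c < E.k + 2 then E.w ⟨c, h⟩ else E.w 0

theorem vert_of_lt (E : EarData G x) {c : ℕ} (h : c < E.k + 2) : E.vert c = E.w ⟨c, h⟩ :=
  dif_pos h

theorem w_eq_vert (E : EarData G x) (i : Fin (E.k + 2)) : E.w i = E.vert i :=
  (E.vert_of_lt i.2).symm

theorem ne_zero_iff {n : ℕ} (i : Fin (n + 2)) : i ≠ 0 ↔ 1 ≤ (i : ℕ) := by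
  rw [Ne, Fin.ext_iff, Fin.val_zero]
  omega

theorem ne_last_iff {n : ℕ} (i : Fin (n + 2)) : i ≠ Fin.last (n + 1) ↔ (i : ℕ) ≤ n := by
  rw [Ne, Fin.ext_iff, Fin.val_last]
  omega

theorem vert_ne_goal (E : EarData G x) {a : ℕ} (h1 : 1 ≤ a) (h2 : a ≤ E.k) : E.vert a ≠ x := by
  rw [E.vert_of_lt (by omega)]
  exact E.notx _ ((ne_zero_iff _).2 h1) ((ne_last_iff _).2 h2)

theorem eq_of_vert_eq (E : EarData G x) {a b : ℕ} (h1 : 1 ≤ a) (h2 : a ≤ E.k)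
    (hb : b ≤ E.k + 1) (h : E.vert a = E.vert b) : a = b := by
  rw [E.vert_of_lt (by omega), E.vert_of_lt (by omega)] at h
  exact Fin.ext_iff.1 (E.inj _ _ ((ne_zero_iff _).2 h1) ((ne_last_iff _).2 h2) h)

theorem neighborSet_vert (E : EarData G x) {a : ℕ} (h1 : 1 ≤ a) (h2 : a ≤ E.k) :
    G.neighborSet (E.vert a) = {E.vert (a - 1), E.vert (a + 1)} := by
  rw [E.vert_of_lt (by omega), E.deg2 _ ((ne_zero_iff _).2 h1) ((ne_last_iff _).2 h2),
    w_eq_vert, w_eq_vert]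
  congr 3
  · rw [Fin.coe_sub_one, if_neg ((ne_zero_iff _).2 h1)]
  · rw [Fin.val_add_one, if_neg ((ne_last_iff _).2 h2)]

theorem adj_vert (E : EarData G x) {a : ℕ} (h1 : 1 ≤ a) (h2 : a ≤ E.k) (u : V) :
    G.Adj (E.vert a) u ↔ u = E.vert (a - 1) ∨ u = E.vert (a + 1) := by
  rw [← SimpleGraph.mem_neighborSet, E.neighborSet_vert h1 h2]
  simp

theorem isUnweightedThread (E : EarData G x) {ω : V → V → ℕ} (h : E.Unweighted ω) :
    IsUnweightedThread G ω x E.k E.vert where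
  ne_goal _ h1 h2 := E.vert_ne_goal h1 h2
  inj _ _ h1 h2 _ h4 := E.eq_of_vert_eq h1 h2 (by omega)
  adj _ h1 h2 u := (E.adj_vert h1 h2 u).1
  weight a _ h2 := by
    have := h ⟨a, by omega⟩
    rwa [w_eq_vert, w_eq_vert] at this

/-- The set of inner vertices of an ear. -/
def inner (E : EarData G x) : Set V := {v | ∃ a, 1 ≤ a ∧ a ≤ E.k ∧ E.vert a = v}

/-- The neighbors of an inner vertex of an ear that are distinct from the goal and have
degree `2` are inner vertices too. -/
theorem mem_inner_of_adj (E : EarData G x) {v u : V} (hv : v ∈ E.inner) (hadj : G.Adj v u)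
    (hx : u ≠ x) (hu : ∃ a b : V, a ≠ b ∧ G.neighborSet u = {a, b}) : u ∈ E.inner := by
  obtain ⟨a, h1, h2, rfl⟩ := hv
  have h0 : u ≠ E.vert 0 := by
    rintro rfl
    have h := E.w_eq_vert 0
    rw [Fin.val_zero] at h
    rcases E.max0 with h' | h'
    · exact hx (h.symm.trans h')
    · exact h' (h ▸ hu)
  have hl : u ≠ E.vert (E.k + 1) := by
    rintro rfl
    have h := E.w_eq_vert (Fin.last (E.k + 1))
    rw [Fin.val_last] at h
    rcases E.maxl with h' | h'
    · exact hx (h.symm.trans h')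
    · exact h' (h ▸ hu)
  rcases (E.adj_vert h1 h2 u).1 hadj with rfl | rfl
  · refine ⟨a - 1, ?_, by omega, rfl⟩
    by_contra h
    exact h0 (by congr 1; omega)
  · refine ⟨a + 1, by omega, ?_, rfl⟩
    by_contra h
    exact hl (by congr 1; omega)

theorem exists_neighborSet_vert (E : EarData G x) (hE : ¬E.IsClosed) {a : ℕ} (h1 : 1 ≤ a)
    (h2 : a ≤ E.k) : ∃ b c : V, b ≠ c ∧ G.neighborSet (E.vert a) = {b, c} := by
  refine ⟨_, _, fun h => ?_, E.neighborSet_vert h1 h2⟩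
  by_cases ha : a = 1
  · subst ha
    by_cases hk : E.k = 1
    · refine hE ?_
      rw [IsClosed, w_eq_vert, w_eq_vert, Fin.val_zero, Fin.val_last, hk]
      exact h
    · have := E.eq_of_vert_eq (by omega) (by omega) (by omega) h.symm
      omega
  · have := E.eq_of_vert_eq (by omega) (by omega) (by omega) h
    omega

theorem inner_subset (E F : EarData G x) (hF : ¬F.IsClosed) {v : V} (hE : v ∈ E.inner)
    (hv : v ∈ F.inner) : F.inner ⊆ E.inner := by
  obtain ⟨a, h1, h2, rfl⟩ := hv
  rintro _ ⟨b, h3, h4, rfl⟩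
  rcases le_total a b with hab | hab
  · induction b, hab using Nat.le_induction with
    | base => exact hE
    | succ b hb ih =>
      exact E.mem_inner_of_adj (ih (by omega) (by omega))
        ((F.adj_vert (by omega) (by omega) _).2 (Or.inr rfl)) (F.vert_ne_goal h3 h4)
        (F.exists_neighborSet_vert hF h3 h4)
  · induction hab using Nat.decreasingInduction with
    | self => exact hE
    | of_succ b hb ih =>
      exact E.mem_inner_of_adj (ih (by omega) (by omega))
        ((F.adj_vert (by omega) (by omega) _).2 (Or.inl rfl)) (F.vert_ne_goal h3 h4)
        (F.exists_neighborSet_vert hF h3 h4)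

/-- If any two distinct pebbled inner vertices of an ear are adjacent, then the distribution is
squished on the ear. -/
theorem squishedOn_of_adj (E : EarData G x) {p : V → ℤ}
    (h : ∀ u ∈ E.inner, ∀ v ∈ E.inner, 0 < p u → 0 < p v → u = v ∨ G.Adj u v) :
    E.SquishedOn p := by
  classical
  by_cases hex : ∃ a, 1 ≤ a ∧ a ≤ E.k ∧ 0 < p (E.vert a)
  · obtain ⟨h1, h2, h3⟩ := Nat.find_spec hex
    refine ⟨⟨Nat.find hex, by omega⟩, fun i hi0 hil hi => ?_⟩
    rw [ne_zero_iff] at hi0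
    rw [ne_last_iff] at hil
    rw [w_eq_vert] at hi
    have hmin : Nat.find hex ≤ i := Nat.find_min' hex ⟨hi0, hil, hi⟩
    rw [Fin.ext_iff]
    rcases h _ ⟨_, h1, h2, rfl⟩ _ ⟨_, hi0, hil, rfl⟩ h3 hi with h | h
    · exact Or.inl (E.eq_of_vert_eq h1 h2 (by omega) h).symm
    · rcases (E.adj_vert h1 h2 _).1 h with h | h
      · have := E.eq_of_vert_eq hi0 hil (by omega) h
        omega
      · have := E.eq_of_vert_eq hi0 hil (by omega) h
        exact Or.inr this
  · refine ⟨0, fun i hi0 hil hi => absurd ⟨i, ?_, ?_, ?_⟩ hex⟩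
    · exact (ne_zero_iff i).1 hi0
    · exact (ne_last_iff i).1 hil
    · rwa [← w_eq_vert]

theorem squishedOn_congr (E : EarData G x) {p q : V → ℤ} (h : ∀ v ∈ E.inner, p v = q v)
    (hp : E.SquishedOn p) : E.SquishedOn q := by
  obtain ⟨j, hj⟩ := hp
  refine ⟨j, fun i hi0 hil hi => hj i hi0 hil ?_⟩
  rwa [h _ ⟨i, (ne_zero_iff i).1 hi0, (ne_last_iff i).1 hil, (E.w_eq_vert i).symm⟩]

end EarData

/-- The inner vertices of the unweighted non-closed ears on which `p` is not squished. -/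
def unsquishedVerts (G : SimpleGraph V) (ω : V → V → ℕ) (x : V) (p : V → ℤ) : Set V :=
  {v | ∃ E : EarData G x, ¬E.IsClosed ∧ E.Unweighted ω ∧ ¬E.SquishedOn p ∧ v ∈ E.inner}

/-- A distribution can be squished on all unweighted non-closed ears. -/
theorem exists_squished [Fintype V] [DecidableEq V] {G : SimpleGraph V} {ω : V → V → ℕ}
    (hsym : ∀ u v : V, ω u v = ω v u) (hω : ∀ u v : V, G.Adj u v → 2 ≤ ω u v) {x : V} {t : ℕ}
    (p : V → ℤ) (hp : IsDistrib p) (hnr : ¬Reaches G ω p x t) :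
    ∃ q : V → ℤ, IsDistrib q ∧ size q = size p ∧ ¬Reaches G ω q x t ∧
      ∀ E : EarData G x, ¬E.IsClosed → E.Unweighted ω → E.SquishedOn q := by
  induction hn : (unsquishedVerts G ω x p).ncard using Nat.strong_induction_on
    generalizing p with
  | _ n ih =>
    by_cases hall : ∀ E : EarData G x, ¬E.IsClosed → E.Unweighted ω → E.SquishedOn p
    · exact ⟨p, hp, rfl, hnr, hall⟩
    push Not at hall
    obtain ⟨E, hEc, hEu, hEs⟩ := hall
    obtain ⟨q, hq, hsize, hqr, hoff, hqs⟩ :=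
      exists_squished_on_thread hsym hω (E.isUnweightedThread hEu) p hp hnr
    have hadj : ∀ u ∈ E.inner, ∀ v ∈ E.inner, 0 < q u → 0 < q v → u = v ∨ G.Adj u v := by
      rintro _ ⟨a, h1, h2, rfl⟩ _ ⟨b, h3, h4, rfl⟩ ha hb
      have hab := hqs a b h1 h2 h3 h4 ha hb
      have hba := hqs b a h3 h4 h1 h2 hb ha
      rcases lt_trichotomy a b with h | rfl | h
      · obtain rfl : b = a + 1 := by omega
        exact Or.inr ((E.adj_vert h1 h2 _).2 (Or.inr rfl))
      · exact Or.inl rfl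
      · obtain rfl : a = b + 1 := by omega
        exact Or.inr ((E.adj_vert h1 h2 _).2 (Or.inl rfl))
    have hdisj : ∀ F : EarData G x, ¬F.IsClosed → ¬F.SquishedOn q →
        ∀ v ∈ F.inner, v ∉ E.inner := fun F hFc hFs v hF hE =>
      hFs (F.squishedOn_of_adj fun u hu w hw =>
        hadj u (E.inner_subset F hFc hE hF hu) w (E.inner_subset F hFc hE hF hw))
    have hlt : unsquishedVerts G ω x q ⊂ unsquishedVerts G ω x p := by
      refine Set.ssubset_iff_of_subset ?_ |>.2
        ⟨E.vert 1, ⟨E, hEc, hEu, hEs, 1, le_rfl, E.kpos, rfl⟩, ?_⟩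
      · rintro v ⟨F, hFc, hFu, hFs, hv⟩
        refine ⟨F, hFc, hFu, fun h => hFs (F.squishedOn_congr (fun u hu => ?_) h), hv⟩
        exact (hoff u fun a h1 h2 h => hdisj F hFc hFs u hu ⟨a, h1, h2, h.symm⟩).symm
      · rintro ⟨F, hFc, -, hFs, hv⟩
        exact hdisj F hFc hFs _ hv ⟨1, le_rfl, E.kpos, rfl⟩
    obtain ⟨r, hr, hrs, hrr, hall⟩ := ih _ (hn ▸ Set.ncard_lt_ncard hlt) q hq hqr rfl
    exact ⟨r, hr, hrs.trans hsize, hrr, hall⟩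

/-- **Squishing Lemma.** If `x` is not reachable from a pebble
distribution `p` of size `n`, then there is a pebble distribution of size `n` from which
`x` is still not reachable and which is squished on the thread of every unweighted open
ear of `G` with respect to `x`. -/
theorem statement15 {V : Type*} [Fintype V] [DecidableEq V]
    (G : SimpleGraph V) (hG : G.Connected)
    (ω : V → V → ℕ) (hsym : ∀ u v : V, ω u v = ω v u)
    (hω : ∀ u v : V, G.Adj u v → 2 ≤ ω u v)
    (x : V) (p : V → ℤ) (hp : IsDistrib p) (hnr : ¬Reaches G ω p x 1) :
    ∃ q : V → ℤ, IsDistrib q ∧ size q = size p ∧ ¬Reaches G ω q x 1 ∧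
      ∀ E : EarData G x, E.IsOpen → E.Unweighted ω → E.SquishedOn q := by
  obtain ⟨q, hq, hsize, hqr, hall⟩ := exists_squished hsym hω p hp hnr
  exact ⟨q, hq, hsize, hqr, fun E hE => hall E hE.1⟩
end
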